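/- arXiv:1708.06902 — 4 statements merged into one kernel-verified Lean document; each statement's English description precedes it below -/
import Mathlib

section
/- There exist a real number λ > 0 and a function f ∈ C₀⁺[0,1] such that (Lf)(t) = λ·f(t) for all t ∈ [0,1]; that is, the Lyapunov operator L has at least one positive eigenvalue with a nontrivial nonnegative continuous eigenfunction. -/
open MeasureTheory Set

/-- The Lyapunov integral operator `(L f)(t) = ∫₀¹∫₀¹ K(t,u,v) f(u) f(v) du dv`. -/
noncomputable def lyap (K : ℝ → ℝ → ℝ → ℝ) (f : ℝ → ℝ) (t : ℝ) : ℝ :=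
  ∫ u in (0:ℝ)..1, ∫ v in (0:ℝ)..1, K t u v * f u * f v

/-- Lagrange extrapolation to `1` from nodes in `(0, ε]`. -/
lemma exists_extrapolation_weights (D : ℕ) {ε : ℝ} (hε : 0 < ε) :
    ∃ w t : ℕ → ℝ, (∀ i, 0 < t i ∧ t i ≤ ε) ∧ ∑ i ∈ Finset.range (D + 1), w i = 1 ∧
      ∀ P : Polynomial ℝ, P.natDegree ≤ D →
        P.eval 1 = ∑ i ∈ Finset.range (D + 1), w i * P.eval (t i) := by
  set t : ℕ → ℝ := fun i => ε / (i + 1) with ht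
  have hinj : Function.Injective t := by
    intro i j hij
    have h1 : (0 : ℝ) < i + 1 := by positivity
    have h2 : (0 : ℝ) < j + 1 := by positivity
    simp only [ht] at hij
    rw [div_eq_div_iff h1.ne' h2.ne'] at hij
    have := mul_left_cancel₀ hε.ne' hij
    exact_mod_cast (by linarith : (i : ℝ) = j)
  have key : ∀ P : Polynomial ℝ, P.natDegree ≤ D → P.eval 1 = ∑ i ∈ Finset.range (D + 1),
      (Lagrange.basis (Finset.range (D + 1)) t i).eval 1 * P.eval (t i) := by
    intro P hP
    have hdeg : P.degree < ((Finset.range (D + 1)).card : WithBot ℕ) := by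
      rw [Finset.card_range]
      exact lt_of_le_of_lt Polynomial.degree_le_natDegree (by exact_mod_cast Nat.lt_succ_of_le hP)
    conv_lhs => rw [Lagrange.eq_interpolate (hinj.injOn (s := ↑(Finset.range (D + 1)))) hdeg]
    rw [Lagrange.interpolate_apply, Polynomial.eval_finsetSum]
    refine Finset.sum_congr rfl fun i _ => ?_
    rw [Polynomial.eval_mul, Polynomial.eval_C, mul_comm]
  refine ⟨fun i => (Lagrange.basis (Finset.range (D + 1)) t i).eval 1, t, fun i => ⟨?_, ?_⟩, ?_, key⟩
  · positivity
  · exact div_le_self hε.le (by linarith [(Nat.cast_nonneg i : (0 : ℝ) ≤ i)])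
  · simpa using (key 1 (by simp)).symm

lemma exists_polynomial_eval_eq_det {E : Type*} [NormedAddCommGroup E] [NormedSpace ℝ E]
    [FiniteDimensional ℝ E] (A : E →L[ℝ] E) :
    ∃ P : Polynomial ℝ, P.natDegree ≤ Module.finrank ℝ E ∧
      ∀ t : ℝ, P.eval t = (ContinuousLinearMap.id ℝ E + t • A).det := by
  let b := Module.finBasis ℝ E
  let M := LinearMap.toMatrix b b A.toLinearMap
  refine ⟨((Polynomial.X : Polynomial ℝ) • M.map ⇑(Polynomial.C (R := ℝ)) +
    (1 : Matrix (Fin (Module.finrank ℝ E)) (Fin (Module.finrank ℝ E)) ℝ).map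
      ⇑(Polynomial.C (R := ℝ))).det, ?_, fun t => ?_⟩
  · simpa using Polynomial.natDegree_det_X_add_C_le M 1
  · have h1 : (ContinuousLinearMap.id ℝ E + t • A).det =
        LinearMap.det (LinearMap.id + t • A.toLinearMap) := rfl
    rw [h1, ← LinearMap.det_toMatrix b, ← Polynomial.coe_evalRingHom, RingHom.map_det]
    congr 1
    ext i j
    by_cases hij : i = j <;>
    simp [M, hij, add_comm, mul_comm t]

lemma exists_polynomial_eval_eq_norm_sq {E : Type*} [NormedAddCommGroup E] [InnerProductSpace ℝ E]
    (x v : E) (c : ℝ) (N : ℕ) :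
    ∃ P : Polynomial ℝ, P.natDegree ≤ N * 2 ∧
      ∀ t : ℝ, P.eval t = (1 - ‖x + t • v‖ ^ 2 / c) ^ N := by
  refine ⟨(1 - Polynomial.C c⁻¹ * (Polynomial.C (‖x‖ ^ 2) +
    Polynomial.C (2 * inner ℝ x v) * Polynomial.X +
    Polynomial.C (‖v‖ ^ 2) * Polynomial.X ^ 2)) ^ N, ?_, fun t => ?_⟩
  · refine Polynomial.natDegree_pow_le_of_le N ?_
    compute_degree
  · simp only [Polynomial.eval_pow, Polynomial.eval_sub, Polynomial.eval_one, Polynomial.eval_mul,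
      Polynomial.eval_C, Polynomial.eval_add, Polynomial.eval_X]
    rw [norm_add_sq_real, norm_smul, mul_pow, Real.norm_eq_abs, sq_abs, inner_smul_right]
    ring

section

variable {E : Type*} [NormedAddCommGroup E] [InnerProductSpace ℝ E] [FiniteDimensional ℝ E]

/-- For small `t`, `x ↦ x + t • h x` is bijective. -/
lemma bijective_id_add_smul {h : E → E} {C : NNReal} (hC : LipschitzWith C h) {t : ℝ}
    (ht : |t| * C < 1) : Function.Bijective fun x => x + t • h x := by
  constructor
  · intro x y hxy
    have h1 : x - y = t • (h y - h x) := by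
      rw [smul_sub, sub_eq_sub_iff_add_eq_add]; simpa [add_comm] using hxy
    have h2 : ‖x - y‖ ≤ |t| * C * ‖x - y‖ := by
      conv_lhs => rw [h1, norm_smul, Real.norm_eq_abs, norm_sub_rev]
      rw [mul_assoc]
      exact mul_le_mul_of_nonneg_left (hC.norm_sub_le x y) (abs_nonneg t)
    have h3 : ‖x - y‖ = 0 := by nlinarith [norm_nonneg (x - y)]
    exact sub_eq_zero.1 (norm_eq_zero.1 h3)
  · intro y
    have hc : ContractingWith (‖t‖₊ * C) fun x => y - t • h x := by
      refine ⟨by exact_mod_cast ht, LipschitzWith.of_dist_le_mul fun a b => ?_⟩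
      rw [dist_sub_left, dist_smul₀, NNReal.coe_mul, mul_assoc]
      exact mul_le_mul_of_nonneg_left (hC.dist_le_mul a b) (norm_nonneg t)
    refine ⟨hc.fixedPoint, ?_⟩
    have := hc.fixedPoint_isFixedPt
    have h2 : y - t • h hc.fixedPoint = hc.fixedPoint := this
    simp only
    exact (sub_eq_iff_eq_add.1 h2).symm

lemma image_closedBall_id_add_smul {h : E → E} {C : NNReal} (hC : LipschitzWith C h) {t R : ℝ}
    (ht : |t| * C < 1) (hR : ∀ x, R < ‖x‖ → h x = 0) :
    (fun x => x + t • h x) '' Metric.closedBall 0 R = Metric.closedBall 0 R := by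
  obtain ⟨hi, hs⟩ := bijective_id_add_smul hC ht
  have hout : ∀ x, x ∉ Metric.closedBall (0 : E) R → x + t • h x = x := fun x hx => by
    rw [hR x (by simpa using hx), smul_zero, add_zero]
  ext y
  constructor
  · rintro ⟨x, hx, rfl⟩
    by_contra hy
    exact hy (by simpa only [hi (hout _ hy)] using hx)
  · intro hy
    obtain ⟨x, rfl⟩ := hs y
    refine ⟨x, ?_, rfl⟩
    by_contra hx
    exact hx (by simpa only [hout x hx] using hy)

variable [MeasurableSpace E] [BorelSpace E]

lemma setIntegral_comp_id_add_smul {h : E → E} (hh : ContDiff ℝ 1 h) {C : NNReal}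
    (hC : LipschitzWith C h) {t R : ℝ} (ht : |t| * C < 1) (hR : ∀ x, R < ‖x‖ → h x = 0)
    (hdet : ∀ x, 0 < (ContinuousLinearMap.id ℝ E + t • fderiv ℝ h x).det) (g : E → ℝ) :
    ∫ x in Metric.closedBall 0 R, (ContinuousLinearMap.id ℝ E + t • fderiv ℝ h x).det *
      g (x + t • h x) = ∫ x in Metric.closedBall 0 R, g x := by
  have := integral_image_eq_integral_abs_det_fderiv_smul (volume : Measure E)
    (Metric.isClosed_closedBall (x := (0 : E)) (ε := R)).measurableSet
    (f := fun x => x + t • h x) (f' := fun x => ContinuousLinearMap.id ℝ E + t • fderiv ℝ h x)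
    (fun x _ => ((hasFDerivAt_id x).add
      (((hh.differentiable one_ne_zero) x).hasFDerivAt.const_smul t)).hasFDerivWithinAt)
    (bijective_id_add_smul hC ht).1.injOn g
  rw [image_closedBall_id_add_smul hC ht hR] at this
  rw [this]
  simp only [abs_of_pos (hdet _), smul_eq_mul]

/-- The degree-theoretic invariance, for the integrands `(1 - ‖x‖ ^ 2 / c) ^ N`. -/
lemma setIntegral_det_mul_eq {h : E → E} (hh : ContDiff ℝ 1 h) (hs : HasCompactSupport h)
    {R : ℝ} (hR : ∀ x, R < ‖x‖ → h x = 0) (c : ℝ) (N : ℕ) :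
    ∫ x in Metric.closedBall (0 : E) R, (ContinuousLinearMap.id ℝ E + fderiv ℝ h x).det *
      (1 - ‖x + h x‖ ^ 2 / c) ^ N = ∫ x in Metric.closedBall (0 : E) R, (1 - ‖x‖ ^ 2 / c) ^ N := by
  obtain ⟨C, hC⟩ := ContDiff.lipschitzWith_of_hasCompactSupport hs hh one_ne_zero
  have hcont := (ContinuousLinearMap.continuous_det (𝕜 := ℝ) (E := E)).continuousAt
    (x := ContinuousLinearMap.id ℝ E)
  have hpos : ∀ᶠ A in nhds (ContinuousLinearMap.id ℝ E), 0 < A.det :=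
    hcont.eventually (lt_mem_nhds (by
      change (0 : ℝ) < LinearMap.det LinearMap.id
      simp))
  obtain ⟨δ, hδ, hball⟩ := Metric.eventually_nhds_iff.1 hpos
  obtain ⟨ε, hε, hε1, hε2⟩ : ∃ ε : ℝ, 0 < ε ∧ ε * C < 1 ∧ ε * C < δ := by
    have hC0 : (0 : ℝ) < C + 1 := by positivity
    refine ⟨min 1 δ / (C + 1), by positivity, ?_, ?_⟩
    · rw [div_mul_eq_mul_div, div_lt_iff₀ hC0]
      nlinarith [min_le_left 1 δ, lt_min one_pos hδ, C.coe_nonneg]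
    · rw [div_mul_eq_mul_div, div_lt_iff₀ hC0]
      nlinarith [min_le_right 1 δ, lt_min one_pos hδ, C.coe_nonneg]
  obtain ⟨w, t, ht, hw, hP⟩ := exists_extrapolation_weights (Module.finrank ℝ E + N * 2) hε
  have hfd : Continuous (fderiv ℝ h) := hh.continuous_fderiv one_ne_zero
  have hsmall : ∀ i, |t i| * C ≤ ε * C := fun i => by
    rw [abs_of_pos (ht i).1]
    exact mul_le_mul_of_nonneg_right (ht i).2 C.coe_nonneg
  have hstep : ∀ i, ∫ x in Metric.closedBall (0 : E) R,
      (ContinuousLinearMap.id ℝ E + t i • fderiv ℝ h x).det *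
        (1 - ‖x + t i • h x‖ ^ 2 / c) ^ N =
      ∫ x in Metric.closedBall (0 : E) R, (1 - ‖x‖ ^ 2 / c) ^ N := fun i =>
    setIntegral_comp_id_add_smul hh hC ((hsmall i).trans_lt hε1) hR (fun x => hball (by
      rw [dist_eq_norm, add_sub_cancel_left, norm_smul, Real.norm_eq_abs]
      exact ((mul_le_mul_of_nonneg_left (norm_fderiv_le_of_lipschitz ℝ hC)
        (abs_nonneg _)).trans (hsmall i)).trans_lt hε2)) fun x => (1 - ‖x‖ ^ 2 / c) ^ N
  have hpt : ∀ x, (ContinuousLinearMap.id ℝ E + fderiv ℝ h x).det * (1 - ‖x + h x‖ ^ 2 / c) ^ N =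
      ∑ i ∈ Finset.range (Module.finrank ℝ E + N * 2 + 1),
        w i * ((ContinuousLinearMap.id ℝ E + t i • fderiv ℝ h x).det *
          (1 - ‖x + t i • h x‖ ^ 2 / c) ^ N) := by
    intro x
    obtain ⟨P, hPd, hPe⟩ := exists_polynomial_eval_eq_det (fderiv ℝ h x)
    obtain ⟨Q, hQd, hQe⟩ := exists_polynomial_eval_eq_norm_sq x (h x) c N
    have := hP (P * Q) (Polynomial.natDegree_mul_le_of_le hPd hQd)
    simpa only [Polynomial.eval_mul, hPe, hQe, one_smul] using this
  simp_rw [hpt]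
  rw [integral_finsetSum]
  · simp_rw [integral_const_mul, hstep]
    rw [← Finset.sum_mul, hw, one_mul]
  · intro i _
    have hc' := hh.continuous
    refine Integrable.const_mul ?_ _
    refine ContinuousOn.integrableOn_compact (isCompact_closedBall _ _) (Continuous.continuousOn ?_)
    refine Continuous.mul (ContinuousLinearMap.continuous_det.comp (by fun_prop)) (by fun_prop)

/-- A `C¹` map which differs from the identity by a compactly supported map vanishes somewhere. -/
theorem exists_add_eq_zero_of_hasCompactSupport {h : E → E} (hh : ContDiff ℝ 1 h)
    (hs : HasCompactSupport h) : ∃ x, x + h x = 0 := by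
  by_contra! hne
  have hcont : Continuous fun x => x + h x := continuous_id.add hh.continuous
  obtain ⟨R₀, hR₀⟩ := hs.isCompact.isBounded.subset_closedBall 0
  obtain ⟨B, hB⟩ := hs.exists_bound_of_continuous hh.continuous
  have hB0 : 0 ≤ B := (norm_nonneg _).trans (hB 0)
  set R : ℝ := max R₀ 0 + B + 1
  have hRpos : 0 < R := by positivity
  have hz : ∀ x, R₀ < ‖x‖ → h x = 0 := fun x hx => by
    by_contra hx'
    have := hR₀ (subset_tsupport h hx')
    simp at this
    linarith
  have hR : ∀ x, R < ‖x‖ → h x = 0 := fun x hx => hz x (by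
    linarith [le_max_left R₀ 0])
  have hle : ∀ x ∈ Metric.closedBall (0 : E) R, ‖x + h x‖ ≤ R := fun x hx => by
    rcases le_or_gt ‖x‖ R₀ with hx' | hx'
    · linarith [norm_add_le x (h x), hB x, le_max_left R₀ 0]
    · simpa [hz x hx'] using hx
  obtain ⟨x₀, -, hx₀⟩ := (isCompact_closedBall (0 : E) R).exists_isMinOn
    (Metric.nonempty_closedBall.2 hRpos.le) hcont.norm.continuousOn
  set r : ℝ := ‖x₀ + h x₀‖
  have hr : 0 < r := norm_pos_iff.2 (hne x₀)
  have hrR : r ≤ R := by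
    simpa using (hx₀ (Metric.mem_closedBall_self hRpos.le)).trans (hle 0 (by simpa using hRpos.le))
  set J : E → ℝ := fun x => (ContinuousLinearMap.id ℝ E + fderiv ℝ h x).det
  have hfd : Continuous (fderiv ℝ h) := hh.continuous_fderiv one_ne_zero
  have hJc : Continuous J := ContinuousLinearMap.continuous_det.comp (by fun_prop)
  set q : ℝ := 1 - r ^ 2 / R ^ 2
  set q' : ℝ := 1 - (r / 2) ^ 2 / R ^ 2
  have hq0 : 0 ≤ q := by
    rw [sub_nonneg, div_le_one (by positivity)]; gcongr
  have hqq' : q < q' := by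
    apply sub_lt_sub_left
    gcongr
    linarith
  have hq'0 : 0 < q' := hq0.trans_lt hqq'
  set K : ℝ := ∫ x in Metric.closedBall (0 : E) R, |J x|
  set V : ℝ := volume.real (Metric.closedBall (0 : E) (r / 2))
  have hV : 0 < V := ENNReal.toReal_pos (Metric.measure_closedBall_pos _ _ (by positivity)).ne'
    (isCompact_closedBall _ _).measure_lt_top.ne
  have hbound : ∀ N : ℕ, q' ^ N * V ≤ q ^ N * K := by
    intro N
    have heq := setIntegral_det_mul_eq hh hs hR (R ^ 2) N
    have hpc : Continuous fun x : E => (1 - ‖x‖ ^ 2 / R ^ 2) ^ N := by fun_prop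
    have hupper : ∫ x in Metric.closedBall (0 : E) R, J x * (1 - ‖x + h x‖ ^ 2 / R ^ 2) ^ N ≤
        q ^ N * K := by
      rw [← integral_const_mul]
      refine setIntegral_mono_on ?_ ?_ Metric.isClosed_closedBall.measurableSet fun x hx => ?_
      · exact (hJc.mul (hpc.comp hcont)).continuousOn.integrableOn_compact (isCompact_closedBall _ _)
      · exact (hJc.abs.const_smul (q ^ N)).continuousOn.integrableOn_compact
          (isCompact_closedBall _ _)
      · have h1 : 0 ≤ 1 - ‖x + h x‖ ^ 2 / R ^ 2 := by
          rw [sub_nonneg, div_le_one (by positivity)]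
          have := hle x hx
          gcongr
        have h2 : 1 - ‖x + h x‖ ^ 2 / R ^ 2 ≤ q := by
          have : r ≤ ‖x + h x‖ := hx₀ hx
          simp only [q]
          gcongr
        rw [mul_comm (q ^ N)]
        exact mul_le_mul (le_abs_self _) (pow_le_pow_left₀ h1 h2 N) (pow_nonneg h1 N)
          (abs_nonneg _)
    have hlower : q' ^ N * V ≤ ∫ x in Metric.closedBall (0 : E) R, (1 - ‖x‖ ^ 2 / R ^ 2) ^ N := by
      have hsub : Metric.closedBall (0 : E) (r / 2) ⊆ Metric.closedBall 0 R :=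
        Metric.closedBall_subset_closedBall (by linarith)
      calc q' ^ N * V = ∫ x in Metric.closedBall (0 : E) (r / 2), q' ^ N := by
            rw [setIntegral_const, smul_eq_mul, mul_comm]
        _ ≤ ∫ x in Metric.closedBall (0 : E) (r / 2), (1 - ‖x‖ ^ 2 / R ^ 2) ^ N := by
            refine setIntegral_mono_on ?_ ?_ Metric.isClosed_closedBall.measurableSet fun x hx => ?_
            · exact continuousOn_const.integrableOn_compact (isCompact_closedBall _ _)
            · exact hpc.continuousOn.integrableOn_compact (isCompact_closedBall _ _)
            · have hx' : ‖x‖ ≤ r / 2 := by simpa using hx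
              refine pow_le_pow_left₀ hq'0.le ?_ N
              simp only [q']
              gcongr
        _ ≤ _ := by
            refine setIntegral_mono_set
              (hpc.continuousOn.integrableOn_compact (isCompact_closedBall _ _)) ?_
              hsub.eventuallyLE
            refine (ae_restrict_iff' Metric.isClosed_closedBall.measurableSet).2
              (Filter.Eventually.of_forall fun x hx => pow_nonneg ?_ N)
            have hx' : ‖x‖ ≤ R := by simpa using hx
            rw [sub_nonneg, div_le_one (by positivity)]
            gcongr
    exact hlower.trans (heq ▸ hupper)
  have hlim : Filter.Tendsto (fun N : ℕ => (q / q') ^ N * K) Filter.atTop (nhds (0 * K)) :=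
    (tendsto_pow_atTop_nhds_zero_of_lt_one (div_nonneg hq0 hq'0.le)
      ((div_lt_one hq'0).2 hqq')).mul_const K
  have := ge_of_tendsto' hlim (b := V) fun N => by
    rw [div_pow, div_mul_eq_mul_div, le_div_iff₀ (pow_pos hq'0 N), mul_comm V]
    exact hbound N
  linarith

end

/-- Brouwer's fixed point theorem for bounded `C¹` maps. -/
theorem exists_fixedPoint_of_bounded {E : Type*} [NormedAddCommGroup E] [InnerProductSpace ℝ E]
    [FiniteDimensional ℝ E] {F : E → E} (hF : ContDiff ℝ 1 F) {M : ℝ}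
    (hM : ∀ x, ‖F x‖ ≤ M) : ∃ x, F x = x := by
  borelize E
  have hM0 : 0 ≤ M := (norm_nonneg _).trans (hM 0)
  let φ : ContDiffBump (0 : E) := ⟨M + 1, M + 2, by linarith, by linarith⟩
  obtain ⟨x, hx⟩ := exists_add_eq_zero_of_hasCompactSupport (h := fun x => -(φ x • F x))
    ((φ.contDiff.smul hF).neg) (φ.hasCompactSupport.smul_right (f' := F)).neg
  have hx' : φ x • F x = x := by rw [← sub_eq_add_neg, sub_eq_zero] at hx; exact hx.symm
  have hn : ‖x‖ ≤ M := by
    rw [← hx', norm_smul, Real.norm_eq_abs, abs_of_nonneg φ.nonneg]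
    nlinarith [hM x, φ.le_one (x := x), norm_nonneg (F x), φ.nonneg (x := x)]
  refine ⟨x, ?_⟩
  rw [φ.one_of_mem_closedBall (by simpa [φ] using hn.trans (by linarith)), one_smul] at hx'
  exact hx'

/-- A finite-dimensional quadratic map with positive coefficients has a nonnegative eigenvector. -/
theorem exists_eigenvector_of_pos_coeff {ι : Type*} [Fintype ι] [Nonempty ι] {c : ι → ι → ι → ℝ}
    (hc : ∀ i j k, 0 < c i j k) :
    ∃ (x : ι → ℝ) (lam : ℝ), 0 < lam ∧ (∀ i, 0 ≤ x i) ∧ ∑ i, x i = 1 ∧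
      ∀ i, ∑ j, ∑ k, c i j k * (x j * x k) = lam * x i := by
  classical
  -- At a fixed point of norm one the correction term vanishes; elsewhere it keeps `u` nonzero.
  let u : EuclideanSpace ℝ ι → ι → ℝ := fun y j => y j ^ 2 + (1 - ∑ i, y i ^ 2) ^ 2
  let Q : EuclideanSpace ℝ ι → ι → ℝ := fun y i => ∑ j, ∑ k, c i j k * (u y j * u y k)
  have hu0 : ∀ y j, 0 ≤ u y j := fun y j => by positivity
  have hu : ∀ y, ∃ j, 0 < u y j := fun y => by
    by_contra! hle
    have h0 : ∀ j, y j ^ 2 + (1 - ∑ i, y i ^ 2) ^ 2 ≤ 0 := hle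
    have h1 : ∀ j, y j ^ 2 = 0 := fun j => le_antisymm
      (by nlinarith [h0 j, sq_nonneg (1 - ∑ i, y i ^ 2)]) (sq_nonneg _)
    have h2 := h0 (Classical.arbitrary ι)
    simp only [h1, Finset.sum_const_zero] at h2
    norm_num at h2
  have hQ : ∀ y i, 0 < Q y i := fun y i => by
    obtain ⟨j, hj⟩ := hu y
    have hnn : ∀ j k, 0 ≤ c i j k * (u y j * u y k) := fun j k =>
      mul_nonneg (hc i j k).le (mul_nonneg (hu0 y j) (hu0 y k))
    exact Finset.sum_pos' (fun j _ => Finset.sum_nonneg fun k _ => hnn j k)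
      ⟨j, Finset.mem_univ j, Finset.sum_pos' (fun k _ => hnn j k)
        ⟨j, Finset.mem_univ j, mul_pos (hc i j j) (mul_pos hj hj)⟩⟩
  have hS : ∀ y, 0 < ∑ i, Q y i := fun y => Finset.sum_pos (fun i _ => hQ y i) Finset.univ_nonempty
  have hus : ∀ j, ContDiff ℝ 1 fun y => u y j := fun j => by
    have hcoord : ∀ i : ι, ContDiff ℝ 1 fun y : EuclideanSpace ℝ ι => y i := fun i =>
      contDiff_euclidean.1 contDiff_id i
    exact ((hcoord j).pow 2).add
      ((contDiff_const.sub (ContDiff.sum fun i _ => (hcoord i).pow 2)).pow 2)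
  have hQs : ∀ i, ContDiff ℝ 1 fun y => Q y i := fun i =>
    ContDiff.sum fun j _ => ContDiff.sum fun k _ => contDiff_const.mul ((hus j).mul (hus k))
  let F : EuclideanSpace ℝ ι → EuclideanSpace ℝ ι := fun y =>
    WithLp.toLp 2 fun i => Real.sqrt (Q y i / ∑ l, Q y l)
  have hFsq : ∀ y i, F y i ^ 2 = Q y i / ∑ l, Q y l := fun y i =>
    Real.sq_sqrt (div_nonneg (hQ y i).le (hS y).le)
  have hFsum : ∀ y, ∑ i, F y i ^ 2 = 1 := fun y => by
    simp only [hFsq]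
    rw [← Finset.sum_div, div_self (hS y).ne']
  have hFs : ContDiff ℝ 1 F := contDiff_euclidean.2 fun i =>
    ((hQs i).div (ContDiff.sum fun l _ => hQs l) fun y => (hS y).ne').sqrt
      fun y => (div_pos (hQ y i) (hS y)).ne'
  obtain ⟨y, hy⟩ := exists_fixedPoint_of_bounded hFs (M := 1) fun y => by
    simp [EuclideanSpace.norm_eq, hFsum]
  have hy1 : ∑ i, y i ^ 2 = 1 := by simpa only [hy] using hFsum y
  have huy : ∀ j, u y j = y j ^ 2 := fun j => by simp [u, hy1]
  refine ⟨fun i => y i ^ 2, ∑ l, Q y l, hS y, fun i => sq_nonneg _, hy1, fun i => ?_⟩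
  have h1 := hFsq y i
  rw [hy, eq_div_iff (hS y).ne'] at h1
  rw [mul_comm, h1]
  simp only [Q, huy]

lemma ContinuousMap.integrable_of_compactSpace {X : Type*} [TopologicalSpace X] [CompactSpace X]
    [MeasurableSpace X] [OpensMeasurableSpace X] {μ : Measure X} [IsFiniteMeasure μ]
    (g : C(X, ℝ)) : Integrable g μ :=
  g.continuous.integrable_of_hasCompactSupport (HasCompactSupport.of_compactSpace g)

lemma ContinuousMap.continuous_integral_apply {X : Type*} [TopologicalSpace X] [CompactSpace X]
    [MeasurableSpace X] [OpensMeasurableSpace X] (μ : Measure X) [IsProbabilityMeasure μ] :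
    Continuous fun g : C(X, ℝ) => ∫ x, g x ∂μ := by
  refine (LipschitzWith.of_dist_le_mul (K := 1) fun g g' => ?_).continuous
  rw [dist_eq_norm, ← integral_sub g.integrable_of_compactSpace g'.integrable_of_compactSpace,
    NNReal.coe_one, one_mul, dist_eq_norm]
  simpa using norm_integral_le_of_norm_le_const (μ := μ)
    (Filter.Eventually.of_forall fun x => (g - g').norm_coe_le_norm x)

lemma unitInterval.intervalIntegral_eq_integral (g : ℝ → ℝ) :
    ∫ x in (0:ℝ)..1, g x = ∫ x : unitInterval, g x := by
  rw [intervalIntegral.integral_of_le zero_le_one, ← integral_Icc_eq_integral_Ioc]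
  exact (integral_subtype measurableSet_Icc g).symm

lemma integral_bernstein_pos (n : ℕ) (k : Fin (n + 1)) :
    0 < ∫ x : unitInterval, bernstein n k x := by
  have h : ∀ x : unitInterval,
      bernstein n k x = (n.choose k : ℝ) * (x : ℝ) ^ (k : ℕ) * (1 - (x : ℝ)) ^ (n - k) :=
    fun x => bernstein_apply n k x
  simp_rw [h]
  rw [← unitInterval.intervalIntegral_eq_integral
    fun x => (n.choose k : ℝ) * x ^ (k : ℕ) * (1 - x) ^ (n - k)]
  refine intervalIntegral.intervalIntegral_pos_of_pos_on
    (Continuous.intervalIntegrable (by fun_prop) 0 1) (fun x hx => ?_) zero_lt_one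
  have h1 : 0 < x := hx.1
  have h2 : 0 < 1 - x := sub_pos.2 hx.2
  have h3 : (0 : ℝ) < n.choose k := by exact_mod_cast Nat.choose_pos (Nat.lt_succ_iff.1 k.2)
  positivity

lemma norm_bernsteinApproximation_sub_le (n : ℕ) (f g : C(unitInterval, ℝ)) :
    ‖bernsteinApproximation n f - bernsteinApproximation n g‖ ≤ ‖f - g‖ := by
  refine (ContinuousMap.norm_le _ (norm_nonneg _)).2 fun x => ?_
  rw [ContinuousMap.sub_apply, bernsteinApproximation.apply, bernsteinApproximation.apply,
    ← Finset.sum_sub_distrib]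
  calc ‖∑ k : Fin (n + 1), (bernstein n k x • f (bernstein.z k) -
          bernstein n k x • g (bernstein.z k))‖
      ≤ ∑ k : Fin (n + 1), bernstein n k x * ‖f - g‖ := by
        refine norm_sum_le_of_le _ fun k _ => ?_
        rw [← smul_sub, norm_smul, Real.norm_of_nonneg bernstein_nonneg]
        exact mul_le_mul_of_nonneg_left ((f - g).norm_coe_le_norm _) bernstein_nonneg
    _ = ‖f - g‖ := by rw [← Finset.sum_mul, bernstein.probability, one_mul]

section

open unitInterval

/-- `(u, v) ↦ f u * f v`. -/
def tensorSq (f : C(I, ℝ)) : C(I × I, ℝ) := ⟨fun p => f p.1 * f p.2, by fun_prop⟩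

lemma continuous_tensorSq : Continuous tensorSq := by
  have h1 : Continuous fun f : C(I, ℝ) => f.comp (⟨Prod.fst, continuous_fst⟩ : C(I × I, I)) :=
    ContinuousMap.continuous_precomp _
  have h2 : Continuous fun f : C(I, ℝ) => f.comp (⟨Prod.snd, continuous_snd⟩ : C(I × I, I)) :=
    ContinuousMap.continuous_precomp _
  exact h1.mul h2

lemma integral_tensorSq (f : C(I, ℝ)) : ∫ p, tensorSq f p = (∫ x, f x) ^ 2 := by
  rw [sq]
  exact integral_prod_mul (μ := (volume : Measure I)) (ν := (volume : Measure I)) f f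

/-- The quadratic integral operator with kernel `κ`, as a self-map of `C(I, ℝ)`. -/
noncomputable def quadOp (κ : C(I, C(I × I, ℝ))) (f : C(I, ℝ)) : C(I, ℝ) :=
  ⟨fun t => ∫ p, (κ t * tensorSq f) p,
    (ContinuousMap.continuous_integral_apply _).comp (κ.continuous.mul continuous_const)⟩

lemma quadOp_apply (κ : C(I, C(I × I, ℝ))) (f : C(I, ℝ)) (t : I) :
    quadOp κ f t = ∫ p : I × I, κ t p * (f p.1 * f p.2) := rfl

lemma continuous_quadOp_apply (κ : C(I, C(I × I, ℝ))) (t : I) :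
    Continuous fun f => quadOp κ f t :=
  (ContinuousMap.continuous_integral_apply _).comp (continuous_const.mul continuous_tensorSq)

lemma quadOp_smul (κ : C(I, C(I × I, ℝ))) (a : ℝ) (f : C(I, ℝ)) (t : I) :
    quadOp κ (a • f) t = a ^ 2 * quadOp κ f t := by
  rw [quadOp_apply, quadOp_apply, ← integral_const_mul]
  congr 1 with p
  simp only [ContinuousMap.smul_apply, smul_eq_mul]
  ring

lemma quadOp_sum {ι : Type*} [Fintype ι] (κ : C(I, C(I × I, ℝ))) (b : ι → C(I, ℝ)) (x : ι → ℝ)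
    (t : I) : quadOp κ (∑ j, x j • b j) t =
      ∑ j, ∑ k, (∫ p : I × I, κ t p * (b j p.1 * b k p.2)) * (x j * x k) := by
  have hint : ∀ j k, Integrable fun p : I × I => κ t p * (b j p.1 * b k p.2) := fun j k =>
    ContinuousMap.integrable_of_compactSpace
      ⟨fun p : I × I => κ t p * (b j p.1 * b k p.2), by fun_prop⟩
  simp_rw [← integral_mul_const]
  rw [quadOp_apply]
  simp_rw [← integral_finsetSum _ fun k _ => (hint _ k).mul_const _]
  rw [← integral_finsetSum _ fun j _ => integrable_finsetSum _ fun k _ => (hint j k).mul_const _]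
  congr 1 with p
  simp only [ContinuousMap.sum_apply, ContinuousMap.smul_apply, smul_eq_mul]
  rw [Finset.sum_mul_sum, Finset.mul_sum]
  simp_rw [Finset.mul_sum]
  refine Finset.sum_congr rfl fun j _ => Finset.sum_congr rfl fun k _ => ?_
  ring

lemma le_quadOp {κ : C(I, C(I × I, ℝ))} {m : ℝ} (hm : ∀ t p, m ≤ κ t p) {f : C(I, ℝ)}
    (hf : ∀ x, 0 ≤ f x) (hf1 : ∫ x, f x = 1) (t : I) : m ≤ quadOp κ f t := by
  calc m = ∫ p, m * tensorSq f p := by rw [integral_const_mul, integral_tensorSq, hf1]; ring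
    _ ≤ _ := integral_mono ((tensorSq f).integrable_of_compactSpace.const_mul m)
      (κ t * tensorSq f).integrable_of_compactSpace fun p =>
        mul_le_mul_of_nonneg_right (hm t p) (mul_nonneg (hf _) (hf _))

lemma abs_integral_mul_tensorSq_le (g : C(I × I, ℝ)) {f : C(I, ℝ)}
    (hf : ∀ x, 0 ≤ f x) (hf1 : ∫ x, f x = 1) : |∫ p, (g * tensorSq f) p| ≤ ‖g‖ := by
  have hle : ∀ p, ‖(g * tensorSq f) p‖ ≤ ‖g‖ * tensorSq f p := fun p => by
    rw [ContinuousMap.mul_apply, norm_mul,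
      Real.norm_of_nonneg (show 0 ≤ tensorSq f p from mul_nonneg (hf _) (hf _))]
    exact mul_le_mul_of_nonneg_right (g.norm_coe_le_norm p) (mul_nonneg (hf _) (hf _))
  have h := norm_integral_le_of_norm_le (μ := (volume : Measure (I × I)))
    ((tensorSq f).integrable_of_compactSpace.const_mul ‖g‖) (Filter.Eventually.of_forall hle)
  rwa [integral_const_mul, integral_tensorSq, hf1, one_pow, mul_one] at h

/-- Eigenfunctions of the operator composed with the Bernstein approximation. -/
lemma exists_bernsteinApproximation_quadOp_eq {κ : C(I, C(I × I, ℝ))} {m : ℝ} (hm0 : 0 < m)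
    (hm : ∀ t p, m ≤ κ t p) (n : ℕ) :
    ∃ (lam : ℝ) (f : C(I, ℝ)), 0 < lam ∧ (∀ x, 0 ≤ f x) ∧ ∫ x, f x = 1 ∧
      bernsteinApproximation n (quadOp κ f) = lam • f := by
  let b : Fin (n + 1) → C(I, ℝ) := fun k => bernstein n k
  have hb : ∀ k x, 0 ≤ b k x := fun k x => bernstein_nonneg
  have hc : ∀ i j k : Fin (n + 1),
      0 < ∫ p : I × I, κ (bernstein.z i) p * (b j p.1 * b k p.2) := by
    intro i j k
    have h1 : ∫ p : I × I, b j p.1 * b k p.2 = (∫ x, b j x) * ∫ x, b k x :=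
      integral_prod_mul (μ := (volume : Measure I)) (ν := (volume : Measure I)) (b j) (b k)
    refine (mul_pos hm0 (mul_pos (integral_bernstein_pos n j) (integral_bernstein_pos n k))).trans_le
      ?_
    rw [← h1, ← integral_const_mul]
    exact integral_mono (ContinuousMap.integrable_of_compactSpace
        ⟨fun p : I × I => m * (b j p.1 * b k p.2), by fun_prop⟩)
      (ContinuousMap.integrable_of_compactSpace
        ⟨fun p : I × I => κ (bernstein.z i) p * (b j p.1 * b k p.2), by fun_prop⟩)
      fun p => mul_le_mul_of_nonneg_right (hm _ p) (mul_nonneg (hb _ _) (hb _ _))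
  obtain ⟨x, lam, hlam, hx0, hx1, hx⟩ := exists_eigenvector_of_pos_coeff hc
  set f : C(I, ℝ) := ∑ j, x j • b j with hf
  have hfa : ∀ t, f t = ∑ j, x j * b j t := fun t => by
    simp [hf, ContinuousMap.sum_apply]
  have hs : 0 < ∫ t, f t := by
    simp_rw [hfa]
    rw [integral_finsetSum _ fun j _ => (b j).integrable_of_compactSpace.const_mul (x j)]
    simp_rw [integral_const_mul]
    obtain ⟨j, -, hj⟩ : ∃ j ∈ Finset.univ, 0 < x j := by
      by_contra! hle
      linarith [Finset.sum_nonpos hle]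
    exact Finset.sum_pos' (fun j _ => mul_nonneg (hx0 j) (integral_bernstein_pos n j).le)
      ⟨j, Finset.mem_univ j, mul_pos hj (integral_bernstein_pos n j)⟩
  set s : ℝ := ∫ t, f t
  refine ⟨s⁻¹ * lam, s⁻¹ • f, by positivity, fun t => ?_, ?_, ?_⟩
  · rw [ContinuousMap.smul_apply, smul_eq_mul, hfa]
    exact mul_nonneg (inv_nonneg.2 hs.le)
      (Finset.sum_nonneg fun j _ => mul_nonneg (hx0 j) (hb j t))
  · simp_rw [ContinuousMap.smul_apply, smul_eq_mul]
    rw [integral_const_mul]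
    exact inv_mul_cancel₀ hs.ne'
  · ext t
    rw [bernsteinApproximation.apply, ContinuousMap.smul_apply, ContinuousMap.smul_apply, hfa]
    simp_rw [quadOp_smul, hf, quadOp_sum, hx, smul_eq_mul, Finset.mul_sum]
    refine Finset.sum_congr rfl fun j _ => ?_
    simp only [b]
    ring

lemma isCompact_setOf_modulus (κ : C(I, C(I × I, ℝ))) (M : ℝ) :
    IsCompact {g : C(I, ℝ) | (∀ t, g t ∈ Icc (-M) M) ∧ ∀ t s, |g t - g s| ≤ ‖κ t - κ s‖} := by
  refine ArzelaAscoli.isCompact_of_equicontinuous _ ?_ ?_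
  · have himg : ContinuousMap.toFun '' {g : C(I, ℝ) | (∀ t, g t ∈ Icc (-M) M) ∧
        ∀ t s, |g t - g s| ≤ ‖κ t - κ s‖} =
        Set.pi univ (fun _ => Icc (-M) M) ∩ {g | ∀ t s, |g t - g s| ≤ ‖κ t - κ s‖} := by
      ext g
      constructor
      · rintro ⟨g, hg, rfl⟩
        exact ⟨fun t _ => hg.1 t, hg.2⟩
      · rintro ⟨h1, h2⟩
        refine ⟨⟨g, continuous_iff_continuousAt.2 fun s => ?_⟩, ⟨fun t => h1 t trivial, h2⟩, rfl⟩
        refine tendsto_iff_dist_tendsto_zero.2 (squeeze_zero (fun _ => dist_nonneg)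
          (fun t => h2 t s) ?_)
        simpa [dist_eq_norm] using tendsto_iff_dist_tendsto_zero.1 (κ.continuous.tendsto s)
    rw [himg]
    refine (isCompact_univ_pi fun _ => isCompact_Icc).inter_right ?_
    simp only [ofPred_forall]
    exact isClosed_iInter fun t => isClosed_iInter fun s =>
      isClosed_le (by fun_prop) continuous_const
  · intro s
    refine Metric.equicontinuousAt_of_continuity_modulus (fun t => ‖κ s - κ t‖) ?_ _ ?_
    · have : Continuous fun t => ‖κ s - κ t‖ := by fun_prop
      simpa using this.tendsto s
    · exact Filter.Eventually.of_forall fun t g => g.2.2 s t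

theorem exists_quadOp_eq_smul {κ : C(I, C(I × I, ℝ))} {m : ℝ} (hm0 : 0 < m)
    (hm : ∀ t p, m ≤ κ t p) :
    ∃ (lam : ℝ) (f : C(I, ℝ)), 0 < lam ∧ (∀ x, 0 < f x) ∧ quadOp κ f = lam • f := by
  choose l f hl hf0 hf1 hB using exists_bernsteinApproximation_quadOp_eq hm0 hm
  obtain ⟨G, -, φ, hφ, hG⟩ := (isCompact_setOf_modulus κ ‖κ‖).tendsto_subseq
    (x := fun n => quadOp κ (f n)) fun n => by
      refine ⟨fun t => abs_le.1 ?_, fun t s => ?_⟩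
      · exact (abs_integral_mul_tensorSq_le (κ t) (hf0 n) (hf1 n)).trans (κ.norm_coe_le_norm t)
      · have : quadOp κ (f n) t - quadOp κ (f n) s = ∫ p, ((κ t - κ s) * tensorSq (f n)) p := by
          rw [sub_mul]
          exact (integral_sub (κ t * tensorSq (f n)).integrable_of_compactSpace
            (κ s * tensorSq (f n)).integrable_of_compactSpace).symm
        rw [this]
        exact abs_integral_mul_tensorSq_le _ (hf0 n) (hf1 n)
  have hBG : Filter.Tendsto (fun n => l (φ n) • f (φ n)) Filter.atTop (nhds G) := by
    have h1 := (bernsteinApproximation_uniform G).comp hφ.tendsto_atTop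
    refine tendsto_of_tendsto_of_dist h1 (squeeze_zero (fun _ => dist_nonneg) (fun n => ?_)
      (tendsto_iff_dist_tendsto_zero.1 hG))
    rw [← hB, dist_comm, dist_eq_norm, dist_eq_norm]
    exact norm_bernsteinApproximation_sub_le _ _ _
  have hGm : ∀ t, m ≤ G t := fun t =>
    ge_of_tendsto' (((continuous_eval_const (F := C(I, ℝ)) t).tendsto G).comp hG) fun n =>
      le_quadOp hm (hf0 _) (hf1 _) t
  have hl' : Filter.Tendsto (fun n => l (φ n)) Filter.atTop (nhds (∫ x, G x)) := by
    have := ((ContinuousMap.continuous_integral_apply (volume : Measure I)).tendsto G).comp hBG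
    refine this.congr fun n => ?_
    simp [integral_const_mul, hf1]
  have hlam : 0 < ∫ x, G x := by
    refine hm0.trans_le ?_
    simpa using integral_mono (μ := (volume : Measure I)) (integrable_const m)
      G.integrable_of_compactSpace hGm
  set lam : ℝ := ∫ x, G x
  have hflim : Filter.Tendsto (fun n => f (φ n)) Filter.atTop (nhds (lam⁻¹ • G)) := by
    refine ((hl'.inv₀ hlam.ne').smul hBG).congr fun n => ?_
    rw [smul_smul, inv_mul_cancel₀ (hl _).ne', one_smul]
  refine ⟨lam, lam⁻¹ • G, hlam, fun x => ?_, ?_⟩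
  · exact mul_pos (inv_pos.2 hlam) (hm0.trans_le (hGm x))
  · rw [smul_smul, mul_inv_cancel₀ hlam.ne', one_smul]
    ext t
    exact tendsto_nhds_unique (((continuous_quadOp_apply κ t).tendsto _).comp hflim)
      (((continuous_eval_const (F := C(I, ℝ)) t).tendsto G).comp hG)

end

/-- The Lyapunov operator `L` has at least one positive eigenvalue `λ` with a
nontrivial nonnegative continuous eigenfunction `f ∈ C₀⁺[0,1]`. -/
theorem lyap_exists_positive_eigenvalue
    (K : ℝ → ℝ → ℝ → ℝ)
    (hK : ContinuousOn (fun p : ℝ × ℝ × ℝ => K p.1 p.2.1 p.2.2)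
      ((Set.Icc 0 1) ×ˢ (Set.Icc 0 1) ×ˢ (Set.Icc 0 1)))
    (hKpos : ∀ t ∈ Set.Icc (0:ℝ) 1, ∀ u ∈ Set.Icc (0:ℝ) 1, ∀ v ∈ Set.Icc (0:ℝ) 1,
      0 < K t u v) :
    ∃ (lam : ℝ) (f : ℝ → ℝ), 0 < lam ∧
      ContinuousOn f (Set.Icc 0 1) ∧
      (∀ t ∈ Set.Icc (0:ℝ) 1, 0 ≤ f t) ∧
      (∃ t ∈ Set.Icc (0:ℝ) 1, f t ≠ 0) ∧
      (∀ t ∈ Set.Icc (0:ℝ) 1, lyap K f t = lam * f t) := by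
  let k : C(unitInterval × unitInterval × unitInterval, ℝ) :=
    ⟨fun p => K p.1 p.2.1 p.2.2, hK.comp_continuous
      (f := fun p : unitInterval × unitInterval × unitInterval =>
        ((p.1 : ℝ), (p.2.1 : ℝ), (p.2.2 : ℝ))) (by fun_prop) fun p => ⟨p.1.2, p.2.1.2, p.2.2.2⟩⟩
  obtain ⟨p₀, -, hp₀⟩ := isCompact_univ.exists_isMinOn univ_nonempty k.continuous.continuousOn
  obtain ⟨lam, f, hlam, hf, heq⟩ := exists_quadOp_eq_smul (κ := k.curry)
    (hKpos p₀.1 p₀.1.2 p₀.2.1 p₀.2.1.2 p₀.2.2 p₀.2.2.2) fun t p => hp₀ (mem_univ (t, p))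
  have hproj : ∀ x : unitInterval, projIcc (0 : ℝ) 1 zero_le_one x = x := projIcc_val _
  refine ⟨lam, fun t => f (projIcc 0 1 zero_le_one t), hlam,
    (f.continuous.comp continuous_projIcc).continuousOn, fun t _ => (hf _).le,
    ⟨0, by simp, (hf _).ne'⟩, fun t ht => ?_⟩
  have h := DFunLike.congr_fun heq ⟨t, ht⟩
  rw [ContinuousMap.smul_apply, smul_eq_mul, quadOp_apply] at h
  simp only [projIcc_of_mem _ ht]
  rw [← h, lyap]
  simp_rw [unitInterval.intervalIntegral_eq_integral, hproj]
  have hint : Integrable fun p : unitInterval × unitInterval =>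
      k.curry ⟨t, ht⟩ p * (f p.1 * f p.2) := ContinuousMap.integrable_of_compactSpace
    ⟨fun p => k.curry ⟨t, ht⟩ p * (f p.1 * f p.2), by fun_prop⟩
  refine Eq.trans ?_ (integral_prod _ hint).symm
  simp only [mul_assoc]
  rfl
end

section
/- The set of nontrivial nonnegative continuous fixed points of H and the set of nontrivial nonnegative continuous fixed points of L have the same cardinality; i.e., there is a bijection between {f ∈ C₀⁺[0,1] : Hf = f} and {g ∈ C₀⁺[0,1] : Lg = g}. -/
open MeasureTheory Set

/-- The Lyapunov operator is homogeneous of degree two. -/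
lemma lyap_smul_IccExtend (K : ℝ → ℝ → ℝ → ℝ) (c : ℝ) (f : Set.Icc (0:ℝ) 1 → ℝ) (t : ℝ) :
    lyap K (Set.IccExtend zero_le_one (c • f)) t =
      c ^ 2 * lyap K (Set.IccExtend zero_le_one f) t := by
  simp only [lyap, ← intervalIntegral.integral_const_mul]
  congr! 4 with u v
  simp only [Set.IccExtend, Function.comp_apply, Pi.smul_apply, smul_eq_mul]
  ring

/-- With a positive continuous kernel, the Lyapunov operator maps nontrivial nonnegative
continuous functions to functions that are positive on the unit interval. -/
lemma lyap_IccExtend_pos {K : ℝ → ℝ → ℝ → ℝ}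
    (hK : ContinuousOn (fun p : ℝ × ℝ × ℝ => K p.1 p.2.1 p.2.2)
      ((Set.Icc 0 1) ×ˢ (Set.Icc 0 1) ×ˢ (Set.Icc 0 1)))
    (hKpos : ∀ t ∈ Set.Icc (0:ℝ) 1, ∀ u ∈ Set.Icc (0:ℝ) 1, ∀ v ∈ Set.Icc (0:ℝ) 1,
      0 < K t u v)
    {f : C(Set.Icc (0:ℝ) 1, ℝ)} (hf : ∀ x, 0 ≤ f x) (hf0 : f ≠ 0)
    {t : ℝ} (ht : t ∈ Set.Icc (0:ℝ) 1) :
    0 < lyap K (Set.IccExtend zero_le_one f) t := by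
  let π : ℝ → ℝ := fun x => Set.projIcc (0:ℝ) 1 zero_le_one x
  have hπ : Continuous π := continuous_subtype_val.comp continuous_projIcc
  have hπ_mem (x : ℝ) : π x ∈ Set.Icc (0:ℝ) 1 := (Set.projIcc (0:ℝ) 1 zero_le_one x).2
  have hπ_eq {x : ℝ} (hx : x ∈ Set.Icc (0:ℝ) 1) : π x = x := by
    simp [π, Set.projIcc_of_mem zero_le_one hx]
  set F : ℝ → ℝ := Set.IccExtend zero_le_one f with hF
  have hFc : Continuous F := f.continuous.Icc_extend'
  have hFn (x : ℝ) : 0 ≤ F x := hf _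
  let G : ℝ → ℝ → ℝ := fun u v => K t (π u) (π v) * F u * F v
  have hKc : Continuous fun p : ℝ × ℝ => K t (π p.1) (π p.2) :=
    hK.comp_continuous (f := fun p : ℝ × ℝ => (t, π p.1, π p.2)) (by fun_prop)
      fun p => ⟨ht, hπ_mem _, hπ_mem _⟩
  have hGc : Continuous (Function.uncurry G) :=
    (hKc.mul (hFc.comp continuous_fst)).mul (hFc.comp continuous_snd)
  have hGn (u v : ℝ) : 0 ≤ G u v :=
    mul_nonneg (mul_nonneg (hKpos t ht _ (hπ_mem u) _ (hπ_mem v)).le (hFn u)) (hFn v)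
  have hlyap : lyap K F t = ∫ u in (0:ℝ)..1, ∫ v in (0:ℝ)..1, G u v := by
    refine intervalIntegral.integral_congr fun u hu => intervalIntegral.integral_congr fun v hv => ?_
    rw [Set.uIcc_of_le zero_le_one] at hu hv
    simp only [G, hπ_eq hu, hπ_eq hv]
  obtain ⟨c, hc⟩ : ∃ c, f c ≠ 0 := by
    by_contra! h
    exact hf0 (ContinuousMap.ext h)
  have hFc_pos : 0 < F c := by
    rw [hF, Set.IccExtend_val]
    exact (hf c).lt_of_ne' hc
  rw [hlyap]
  refine intervalIntegral.integral_pos zero_lt_one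
    (intervalIntegral.continuous_parametric_intervalIntegral_of_continuous' hGc 0 1).continuousOn
    (fun u _ => intervalIntegral.integral_nonneg zero_le_one fun v _ => hGn u v) ⟨c, c.2, ?_⟩
  exact intervalIntegral.integral_pos zero_lt_one
    (hGc.comp (Continuous.prodMk_right (c : ℝ))).continuousOn (fun v _ => hGn c v)
    ⟨c, c.2, mul_pos (mul_pos (hKpos t ht _ (hπ_mem c) _ (hπ_mem c)) hFc_pos) hFc_pos⟩

/-- The set of nontrivial nonnegative continuous fixed points of `H` and the set of
nontrivial nonnegative continuous fixed points of `L` are in bijection (have the same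
cardinality).  Continuous functions on `[0,1]` are modelled by `C(Set.Icc 0 1, ℝ)` and
`L` acts through the extension of such a function to `ℝ`. -/
theorem hfix_equiv_lyapfix
    (K : ℝ → ℝ → ℝ → ℝ)
    (hK : ContinuousOn (fun p : ℝ × ℝ × ℝ => K p.1 p.2.1 p.2.2)
      ((Set.Icc 0 1) ×ˢ (Set.Icc 0 1) ×ˢ (Set.Icc 0 1)))
    (hKpos : ∀ t ∈ Set.Icc (0:ℝ) 1, ∀ u ∈ Set.Icc (0:ℝ) 1, ∀ v ∈ Set.Icc (0:ℝ) 1,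
      0 < K t u v)
    :
    Nonempty
      (({f : C(Set.Icc (0:ℝ) 1, ℝ) | (∀ x, 0 ≤ f x) ∧ f ≠ 0 ∧
          ∀ x : Set.Icc (0:ℝ) 1,
            lyap K (Set.IccExtend zero_le_one f) x /
              lyap K (Set.IccExtend zero_le_one f) 0 = f x} : Set C(Set.Icc (0:ℝ) 1, ℝ)) ≃
       ({g : C(Set.Icc (0:ℝ) 1, ℝ) | (∀ x, 0 ≤ g x) ∧ g ≠ 0 ∧
          ∀ x : Set.Icc (0:ℝ) 1,
            lyap K (Set.IccExtend zero_le_one g) x = g x} : Set C(Set.Icc (0:ℝ) 1, ℝ))) := by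
  have h0 : (0:ℝ) ∈ Set.Icc (0:ℝ) 1 := ⟨le_rfl, zero_le_one⟩
  refine ⟨⟨fun f => ⟨(lyap K (Set.IccExtend zero_le_one f.1) 0)⁻¹ • f.1, ?_⟩,
    fun g => ⟨(g.1 ⟨0, h0⟩)⁻¹ • g.1, ?_⟩, ?_, ?_⟩⟩
  · obtain ⟨f, hf, hf0, hfix⟩ := f
    have hL := lyap_IccExtend_pos hK hKpos hf hf0 h0
    refine ⟨fun x => mul_nonneg (inv_nonneg.2 hL.le) (hf x),
      smul_ne_zero (inv_ne_zero hL.ne') hf0, fun x => ?_⟩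
    simp only [ContinuousMap.coe_smul, lyap_smul_IccExtend, Pi.smul_apply, smul_eq_mul, ← hfix x]
    field_simp
  · obtain ⟨g, hg, hg0, hfix⟩ := g
    have hL := lyap_IccExtend_pos hK hKpos hg hg0 h0
    have hfix0 : lyap K (Set.IccExtend zero_le_one g) 0 = g ⟨0, h0⟩ := hfix ⟨0, h0⟩
    rw [hfix0] at hL
    refine ⟨fun x => mul_nonneg (inv_nonneg.2 hL.le) (hg x),
      smul_ne_zero (inv_ne_zero hL.ne') hg0, fun x => ?_⟩
    simp only [ContinuousMap.coe_smul, lyap_smul_IccExtend, hfix0, hfix x, Pi.smul_apply,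
      smul_eq_mul]
    field_simp
  · rintro ⟨f, hf, hf0, hfix⟩
    have hL := lyap_IccExtend_pos hK hKpos hf hf0 h0
    have hf_one : f ⟨0, h0⟩ = 1 := (hfix ⟨0, h0⟩).symm.trans (div_self hL.ne')
    ext x
    simp only [ContinuousMap.smul_apply, smul_eq_mul, hf_one]
    field_simp
  · rintro ⟨g, hg, hg0, hfix⟩
    have hL := lyap_IccExtend_pos hK hKpos hg hg0 h0
    have hfix0 : lyap K (Set.IccExtend zero_le_one g) 0 = g ⟨0, h0⟩ := hfix ⟨0, h0⟩
    rw [hfix0] at hL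
    ext x
    simp only [ContinuousMap.coe_smul, lyap_smul_IccExtend, hfix0, Pi.smul_apply, smul_eq_mul]
    field_simp
end

section
/- If g ∈ C₀⁺[0,1] is a fixed point of the Lyapunov operator L (Lg = g), then ω/Ω² ≤ g(t) ≤ Ω/ω² for every t ∈ [0,1], where Ω = max_{(t,u,v)∈[0,1]³} K(t,u,v) and ω = min_{(t,u,v)∈[0,1]³} K(t,u,v). -/
open MeasureTheory Set

/-- Integrating out one variable of a function continuous on the closed unit square gives an
interval integrable function. -/
theorem intervalIntegrable_integral_of_continuousOn_unitSquare {F : ℝ → ℝ → ℝ}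
    (hF : ContinuousOn (fun p : ℝ × ℝ => F p.1 p.2) (Icc 0 1 ×ˢ Icc 0 1)) :
    IntervalIntegrable (fun u => ∫ v in (0:ℝ)..1, F u v) volume 0 1 := by
  have hint : IntegrableOn (fun p : ℝ × ℝ => F p.1 p.2) (Ioc 0 1 ×ˢ Ioc 0 1)
      (volume.prod volume) :=
    (hF.integrableOn_compact (isCompact_Icc.prod isCompact_Icc)).mono_set
      (prod_mono Ioc_subset_Icc_self Ioc_subset_Icc_self)
  rw [IntegrableOn, ← Measure.prod_restrict] at hint
  rw [intervalIntegrable_iff_integrableOn_Ioc_of_le zero_le_one]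
  simpa only [IntegrableOn, intervalIntegral.integral_of_le (zero_le_one' ℝ)]
    using hint.integral_prod_left

theorem integral_integral_mono_on_unitSquare {F G : ℝ → ℝ → ℝ}
    (hF : ContinuousOn (fun p : ℝ × ℝ => F p.1 p.2) (Icc 0 1 ×ˢ Icc 0 1))
    (hG : ContinuousOn (fun p : ℝ × ℝ => G p.1 p.2) (Icc 0 1 ×ˢ Icc 0 1))
    (hle : ∀ u ∈ Icc (0:ℝ) 1, ∀ v ∈ Icc (0:ℝ) 1, F u v ≤ G u v) :
    ∫ u in (0:ℝ)..1, ∫ v in (0:ℝ)..1, F u v ≤ ∫ u in (0:ℝ)..1, ∫ v in (0:ℝ)..1, G u v := by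
  have hslice : ∀ {H : ℝ → ℝ → ℝ},
      ContinuousOn (fun p : ℝ × ℝ => H p.1 p.2) (Icc 0 1 ×ˢ Icc 0 1) →
      ∀ u ∈ Icc (0:ℝ) 1, IntervalIntegrable (H u) volume 0 1 := fun hH u hu =>
    (hH.comp (f := fun v => (u, v)) (by fun_prop)
      fun v hv => ⟨hu, hv⟩).intervalIntegrable_of_Icc zero_le_one
  exact intervalIntegral.integral_mono_on zero_le_one
    (intervalIntegrable_integral_of_continuousOn_unitSquare hF)
    (intervalIntegrable_integral_of_continuousOn_unitSquare hG) fun u hu =>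
      intervalIntegral.integral_mono_on zero_le_one (hslice hF u hu) (hslice hG u hu) (hle u hu)

theorem lyap_const (c : ℝ) (f : ℝ → ℝ) (t : ℝ) :
    lyap (fun _ _ _ => c) f t = c * (∫ u in (0:ℝ)..1, f u) ^ 2 := by
  simp only [lyap, intervalIntegral.integral_const_mul, intervalIntegral.integral_mul_const]
  ring

theorem lyap_mono_kernel {K K' : ℝ → ℝ → ℝ → ℝ} {f : ℝ → ℝ} {t : ℝ}
    (hK : ContinuousOn (fun p : ℝ × ℝ => K t p.1 p.2) (Icc 0 1 ×ˢ Icc 0 1))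
    (hK' : ContinuousOn (fun p : ℝ × ℝ => K' t p.1 p.2) (Icc 0 1 ×ˢ Icc 0 1))
    (hf : ContinuousOn f (Icc 0 1)) (hf0 : ∀ u ∈ Icc (0:ℝ) 1, 0 ≤ f u)
    (hle : ∀ u ∈ Icc (0:ℝ) 1, ∀ v ∈ Icc (0:ℝ) 1, K t u v ≤ K' t u v) :
    lyap K f t ≤ lyap K' f t := by
  have hfst : ContinuousOn (fun p : ℝ × ℝ => f p.1) (Icc 0 1 ×ˢ Icc 0 1) :=
    hf.comp continuousOn_fst fun p hp => hp.1
  have hsnd : ContinuousOn (fun p : ℝ × ℝ => f p.2) (Icc 0 1 ×ˢ Icc 0 1) :=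
    hf.comp continuousOn_snd fun p hp => hp.2
  exact integral_integral_mono_on_unitSquare ((hK.mul hfst).mul hsnd) ((hK'.mul hfst).mul hsnd)
    fun u hu v hv => mul_le_mul_of_nonneg_right
      (mul_le_mul_of_nonneg_right (hle u hu v hv) (hf0 u hu)) (hf0 v hv)

/-- If `g ∈ C₀⁺[0,1]` is a fixed point of `L`, then `ω/Ω² ≤ g(t) ≤ Ω/ω²` for every
`t ∈ [0,1]`, where `Ω = max K` and `ω = min K` over `[0,1]³`. -/
theorem lyapfix_bounds
    (K : ℝ → ℝ → ℝ → ℝ)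
    (hK : ContinuousOn (fun p : ℝ × ℝ × ℝ => K p.1 p.2.1 p.2.2)
      ((Set.Icc 0 1) ×ˢ (Set.Icc 0 1) ×ˢ (Set.Icc 0 1)))
    (hKpos : ∀ t ∈ Set.Icc (0:ℝ) 1, ∀ u ∈ Set.Icc (0:ℝ) 1, ∀ v ∈ Set.Icc (0:ℝ) 1,
      0 < K t u v)
    (Om om : ℝ)
    (hOm : ∀ t ∈ Set.Icc (0:ℝ) 1, ∀ u ∈ Set.Icc (0:ℝ) 1, ∀ v ∈ Set.Icc (0:ℝ) 1,
      K t u v ≤ Om)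
    (hOmmem : ∃ t ∈ Set.Icc (0:ℝ) 1, ∃ u ∈ Set.Icc (0:ℝ) 1, ∃ v ∈ Set.Icc (0:ℝ) 1,
      K t u v = Om)
    (hom : ∀ t ∈ Set.Icc (0:ℝ) 1, ∀ u ∈ Set.Icc (0:ℝ) 1, ∀ v ∈ Set.Icc (0:ℝ) 1,
      om ≤ K t u v)
    (hommem : ∃ t ∈ Set.Icc (0:ℝ) 1, ∃ u ∈ Set.Icc (0:ℝ) 1, ∃ v ∈ Set.Icc (0:ℝ) 1,
      K t u v = om)
    (g : ℝ → ℝ)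
    (hgcont : ContinuousOn g (Set.Icc 0 1))
    (hgnonneg : ∀ t ∈ Set.Icc (0:ℝ) 1, 0 ≤ g t)
    (hgne : ∃ t ∈ Set.Icc (0:ℝ) 1, g t ≠ 0)
    (hgfix : ∀ t ∈ Set.Icc (0:ℝ) 1, lyap K g t = g t) :
    ∀ t ∈ Set.Icc (0:ℝ) 1, om / Om ^ 2 ≤ g t ∧ g t ≤ Om / om ^ 2 := by
  obtain ⟨t₀, ht₀, u₀, hu₀, v₀, hv₀, hK₀⟩ := hommem
  have hom0 : 0 < om := hK₀ ▸ hKpos t₀ ht₀ u₀ hu₀ v₀ hv₀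
  have hOm0 : 0 < Om := hom0.trans_le <|
    (hom t₀ ht₀ u₀ hu₀ v₀ hv₀).trans (hOm t₀ ht₀ u₀ hu₀ v₀ hv₀)
  have hKslice : ∀ t ∈ Icc (0:ℝ) 1,
      ContinuousOn (fun p : ℝ × ℝ => K t p.1 p.2) (Icc 0 1 ×ˢ Icc 0 1) := fun t ht =>
    hK.comp (f := fun p : ℝ × ℝ => (t, p.1, p.2)) (by fun_prop) fun p hp => ⟨ht, hp.1, hp.2⟩
  set S := ∫ u in (0:ℝ)..1, g u
  have hlower : ∀ t ∈ Icc (0:ℝ) 1, om * S ^ 2 ≤ g t := fun t ht => by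
    rw [← hgfix t ht, ← lyap_const om g t]
    exact lyap_mono_kernel continuousOn_const (hKslice t ht) hgcont hgnonneg (hom t ht)
  have hupper : ∀ t ∈ Icc (0:ℝ) 1, g t ≤ Om * S ^ 2 := fun t ht => by
    rw [← hgfix t ht, ← lyap_const Om g t]
    exact lyap_mono_kernel (hKslice t ht) continuousOn_const hgcont hgnonneg (hOm t ht)
  have hgint : IntervalIntegrable g volume 0 1 := hgcont.intervalIntegrable_of_Icc zero_le_one
  have hSlower : om * S ^ 2 ≤ S := by
    simpa using intervalIntegral.integral_mono_on zero_le_one intervalIntegrable_const hgint hlower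
  have hSupper : S ≤ Om * S ^ 2 := by
    simpa using intervalIntegral.integral_mono_on zero_le_one hgint intervalIntegrable_const hupper
  have hS : 0 < S := by
    obtain ⟨s, hs, hgs⟩ := hgne
    have hS0 : S ≠ 0 := fun h => hgs <|
      le_antisymm (by simpa [h] using hupper s hs) (hgnonneg s hs)
    exact (by positivity : 0 < om * S ^ 2).trans_le hSlower
  have hOmS : 1 ≤ Om * S := by nlinarith
  have homS : om * S ≤ 1 := by nlinarith
  intro t ht
  constructor
  · refine le_trans ?_ (hlower t ht)
    rw [div_le_iff₀ (by positivity)]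
    calc om = om * 1 ^ 2 := by ring
      _ ≤ om * (Om * S) ^ 2 := by gcongr
      _ = om * S ^ 2 * Om ^ 2 := by ring
  · refine (hupper t ht).trans ?_
    rw [le_div_iff₀ (by positivity)]
    calc Om * S ^ 2 * om ^ 2 = Om * (om * S) ^ 2 := by ring
      _ ≤ Om * 1 ^ 2 := by gcongr
      _ = Om := by ring
end

section
/- Suppose the kernel K satisfies max_{(t,u,v)∈[0,1]³} K(t,u,v) < c · min_{(t,u,v)∈[0,1]³} K(t,u,v) for some constant c with 1 < c < (1/2)·√(√17 + 1). Then the equation Hf = f has exactly one solution in C₀⁺[0,1]; i.e., there is a unique nontrivial nonnegative continuous function f on [0,1] with (Lf)(t)/(Lf)(0) = f(t) for all t ∈ [0,1]. -/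
open MeasureTheory Set

lemma lyap_congr {K K' : ℝ → ℝ → ℝ → ℝ} {f f' : ℝ → ℝ} {t : ℝ}
    (hK : ∀ u ∈ Icc (0:ℝ) 1, ∀ v ∈ Icc (0:ℝ) 1, K t u v = K' t u v)
    (hf : EqOn f f' (Icc 0 1)) : lyap K f t = lyap K' f' t := by
  unfold lyap
  refine intervalIntegral.integral_congr fun u hu => intervalIntegral.integral_congr fun v hv => ?_
  rw [uIcc_of_le zero_le_one] at hu hv
  simp only [hK u hu v hv, hf hu, hf hv]

lemma continuous_lyap {K : ℝ → ℝ → ℝ → ℝ} {f : ℝ → ℝ}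
    (hK : Continuous fun p : ℝ × ℝ × ℝ => K p.1 p.2.1 p.2.2) (hf : Continuous f) :
    Continuous (lyap K f) := by
  unfold lyap
  refine intervalIntegral.continuous_parametric_intervalIntegral_of_continuous' ?_ 0 1
  refine intervalIntegral.continuous_parametric_intervalIntegral_of_continuous'
    (f := fun (p : ℝ × ℝ) v => K p.1 p.2 v * f p.2 * f v) ?_ 0 1
  have : Continuous fun p : (ℝ × ℝ) × ℝ => K p.1.1 p.1.2 p.2 :=
    hK.comp (by fun_prop : Continuous fun p : (ℝ × ℝ) × ℝ => (p.1.1, p.1.2, p.2))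
  simp only [Function.uncurry_def]
  fun_prop

lemma continuous_inner_integral {φ : ℝ → ℝ → ℝ} (hφ : Continuous fun p : ℝ × ℝ => φ p.1 p.2) :
    Continuous fun u => ∫ v in (0:ℝ)..1, φ u v :=
  intervalIntegral.continuous_parametric_intervalIntegral_of_continuous' hφ 0 1

lemma integral_integral_sub {φ ψ : ℝ → ℝ → ℝ} (hφ : Continuous fun p : ℝ × ℝ => φ p.1 p.2)
    (hψ : Continuous fun p : ℝ × ℝ => ψ p.1 p.2) :
    ∫ u in (0:ℝ)..1, ∫ v in (0:ℝ)..1, (φ u v - ψ u v) =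
      (∫ u in (0:ℝ)..1, ∫ v in (0:ℝ)..1, φ u v) - ∫ u in (0:ℝ)..1, ∫ v in (0:ℝ)..1, ψ u v := by
  rw [← intervalIntegral.integral_sub ((continuous_inner_integral hφ).intervalIntegrable _ _)
    ((continuous_inner_integral hψ).intervalIntegrable _ _)]
  congr 1 with u
  have h1 : Continuous (φ u) := hφ.comp (Continuous.prodMk_right u)
  have h2 : Continuous (ψ u) := hψ.comp (Continuous.prodMk_right u)
  exact intervalIntegral.integral_sub (h1.intervalIntegrable _ _) (h2.intervalIntegrable _ _)

lemma abs_integral_integral_le {φ : ℝ → ℝ → ℝ} {C : ℝ}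
    (h : ∀ u ∈ Icc (0:ℝ) 1, ∀ v ∈ Icc (0:ℝ) 1, |φ u v| ≤ C) :
    |∫ u in (0:ℝ)..1, ∫ v in (0:ℝ)..1, φ u v| ≤ C := by
  have key : ∀ {ψ : ℝ → ℝ}, (∀ u ∈ Icc (0:ℝ) 1, |ψ u| ≤ C) → |∫ u in (0:ℝ)..1, ψ u| ≤ C := by
    intro ψ hψ
    have := intervalIntegral.norm_integral_le_of_norm_le_const (a := (0:ℝ)) (b := 1) (f := ψ) (C := C)
      fun u hu => hψ u (by rw [uIoc_of_le zero_le_one] at hu; exact Ioc_subset_Icc_self hu)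
    simpa using this
  exact key fun u hu => key fun v hv => h u hu v hv

lemma integral_integral_mono {φ ψ : ℝ → ℝ → ℝ} (hφ : Continuous fun p : ℝ × ℝ => φ p.1 p.2)
    (hψ : Continuous fun p : ℝ × ℝ => ψ p.1 p.2)
    (h : ∀ u ∈ Icc (0:ℝ) 1, ∀ v ∈ Icc (0:ℝ) 1, φ u v ≤ ψ u v) :
    ∫ u in (0:ℝ)..1, ∫ v in (0:ℝ)..1, φ u v ≤ ∫ u in (0:ℝ)..1, ∫ v in (0:ℝ)..1, ψ u v := by
  refine intervalIntegral.integral_mono_on zero_le_one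
    ((continuous_inner_integral hφ).intervalIntegrable _ _)
    ((continuous_inner_integral hψ).intervalIntegrable _ _) fun u hu => ?_
  have h1 : Continuous (φ u) := hφ.comp (Continuous.prodMk_right u)
  have h2 : Continuous (ψ u) := hψ.comp (Continuous.prodMk_right u)
  exact intervalIntegral.integral_mono_on zero_le_one (h1.intervalIntegrable _ _)
    (h2.intervalIntegrable _ _) (h u hu)

lemma integral_integral_const_mul_mul (a : ℝ) (f : ℝ → ℝ) :
    ∫ u in (0:ℝ)..1, ∫ v in (0:ℝ)..1, a * f u * f v = a * (∫ u in (0:ℝ)..1, f u) ^ 2 := by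
  simp only [intervalIntegral.integral_const_mul, intervalIntegral.integral_mul_const]
  ring

lemma continuous_lyap_integrand {K : ℝ → ℝ → ℝ → ℝ} {f : ℝ → ℝ}
    (hK : Continuous fun p : ℝ × ℝ × ℝ => K p.1 p.2.1 p.2.2) (hf : Continuous f) (t : ℝ) :
    Continuous fun p : ℝ × ℝ => K t p.1 p.2 * f p.1 * f p.2 := by
  have : Continuous fun p : ℝ × ℝ => K t p.1 p.2 :=
    hK.comp (by fun_prop : Continuous fun p : ℝ × ℝ => (t, p.1, p.2))
  fun_prop

lemma lyap_mem_Icc {K : ℝ → ℝ → ℝ → ℝ} {f : ℝ → ℝ} {m M : ℝ}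
    (hK : Continuous fun p : ℝ × ℝ × ℝ => K p.1 p.2.1 p.2.2)
    (hb : ∀ t u v, K t u v ∈ Icc m M) (hf : Continuous f)
    (hf0 : ∀ t ∈ Icc (0:ℝ) 1, 0 ≤ f t) (t : ℝ) :
    lyap K f t ∈ Icc (m * (∫ u in (0:ℝ)..1, f u) ^ 2) (M * (∫ u in (0:ℝ)..1, f u) ^ 2) := by
  rw [← integral_integral_const_mul_mul, ← integral_integral_const_mul_mul]
  refine ⟨integral_integral_mono (by fun_prop) (continuous_lyap_integrand hK hf t) ?_,
    integral_integral_mono (continuous_lyap_integrand hK hf t) (by fun_prop) ?_⟩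
  · intro u hu v hv
    have := hf0 u hu
    have := hf0 v hv
    have := (hb t u v).1
    gcongr
  · intro u hu v hv
    have := hf0 u hu
    have := hf0 v hv
    have := (hb t u v).2
    gcongr

lemma lyap_div_mem_Icc {K : ℝ → ℝ → ℝ → ℝ} {f : ℝ → ℝ} {m c : ℝ}
    (hK : Continuous fun p : ℝ × ℝ × ℝ => K p.1 p.2.1 p.2.2) (hm : 0 < m) (hc : 0 < c)
    (hb : ∀ t u v, K t u v ∈ Icc m (c * m)) (hf : Continuous f)
    (hf0 : ∀ t ∈ Icc (0:ℝ) 1, 0 ≤ f t) (h0 : lyap K f 0 ≠ 0) (t : ℝ) :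
    lyap K f t / lyap K f 0 ∈ Icc (1 / c) c := by
  obtain ⟨h1, h2⟩ := lyap_mem_Icc hK hb hf hf0 0
  obtain ⟨h3, h4⟩ := lyap_mem_Icc hK hb hf hf0 t
  have hpos : 0 < lyap K f 0 := lt_of_le_of_ne (le_trans (by positivity) h1) h0.symm
  constructor
  · rw [div_le_div_iff₀ hc hpos]
    nlinarith
  · rw [div_le_iff₀ hpos]
    nlinarith

lemma lyap_zero_lower {K : ℝ → ℝ → ℝ → ℝ} {f : ℝ → ℝ} {m c : ℝ}
    (hK : Continuous fun p : ℝ × ℝ × ℝ => K p.1 p.2.1 p.2.2) (hm : 0 < m) (hc : 0 < c)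
    (hb : ∀ t u v, K t u v ∈ Icc m (c * m)) (hf : Continuous f)
    (hfc : ∀ t, f t ∈ Icc (1 / c) c) (t : ℝ) : m / c ^ 2 ≤ lyap K f t := by
  have h1 := (lyap_mem_Icc hK hb hf (fun t _ => le_trans (by positivity) (hfc t).1) t).1
  have h2 : 1 / c ≤ ∫ u in (0:ℝ)..1, f u := by
    have := intervalIntegral.integral_mono_on zero_le_one
      (intervalIntegrable_const (μ := volume) (c := 1 / c)) (hf.intervalIntegrable 0 1)
      fun u _ => (hfc u).1
    simpa using this
  calc m / c ^ 2 = m * (1 / c) ^ 2 := by ring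
    _ ≤ m * (∫ u in (0:ℝ)..1, f u) ^ 2 := by gcongr
    _ ≤ _ := h1

lemma abs_lyap_div_sub_le {K : ℝ → ℝ → ℝ → ℝ} {f g : ℝ → ℝ} {m c d : ℝ}
    (hK : Continuous fun p : ℝ × ℝ × ℝ => K p.1 p.2.1 p.2.2) (hm : 0 < m) (hc : 1 < c)
    (hb : ∀ t u v, K t u v ∈ Icc m (c * m)) (hf : Continuous f) (hg : Continuous g)
    (hfc : ∀ t, f t ∈ Icc (1 / c) c) (hgc : ∀ t, g t ∈ Icc (1 / c) c)
    (hd : ∀ t, |f t - g t| ≤ d) (t : ℝ) :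
    |lyap K f t / lyap K f 0 - lyap K g t / lyap K g 0| ≤ 2 * c ^ 3 * (c ^ 2 - 1) * d := by
  have hc0 : 0 < c := by linarith
  have hf0 := lyap_zero_lower hK hm hc0 hb hf hfc 0
  have hg0 := lyap_zero_lower hK hm hc0 hb hg hgc 0
  have hmc : 0 < m / c ^ 2 := by positivity
  have hfpos := hmc.trans_le hf0
  have hgpos := hmc.trans_le hg0
  have hd0 : 0 ≤ d := (abs_nonneg _).trans (hd 0)
  obtain ⟨hh1, hh2⟩ := lyap_div_mem_Icc hK hm hc0 hb hg
    (fun t _ => le_trans (by positivity) (hgc t).1) hgpos.ne' t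
  set h := lyap K g t / lyap K g 0 with hh
  have hcf := fun s => continuous_lyap_integrand hK hf s
  have hcg := fun s => continuous_lyap_integrand hK hg s
  have hdiff : lyap K f t - lyap K g t - h * (lyap K f 0 - lyap K g 0) =
      ∫ u in (0:ℝ)..1, ∫ v in (0:ℝ)..1,
        ((K t u v - h * K 0 u v) * (f u * f v - g u * g v)) := by
    simp only [lyap]
    rw [← integral_integral_sub (hcf t) (hcg t), ← integral_integral_sub (hcf 0) (hcg 0)]
    simp only [← intervalIntegral.integral_const_mul]
    rw [← integral_integral_sub ((hcf t).sub (hcg t)) (((hcf 0).sub (hcg 0)).const_mul h)]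
    congr 1 with u
    congr 1 with v
    ring
  have hbound : |lyap K f t - lyap K g t - h * (lyap K f 0 - lyap K g 0)| ≤
      (m * (c ^ 2 - 1)) * (2 * c * d) := by
    rw [hdiff]
    refine abs_integral_integral_le fun u _ v _ => ?_
    rw [abs_mul]
    have hc2 : 0 ≤ c ^ 2 - 1 := by nlinarith
    refine mul_le_mul ?_ ?_ (abs_nonneg _) (by positivity)
    · obtain ⟨a1, a2⟩ := hb t u v
      obtain ⟨b1, b2⟩ := hb 0 u v
      have e1 : m / c ≤ h * K 0 u v := by
        calc m / c = 1 / c * m := by ring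
          _ ≤ h * K 0 u v := by gcongr; exact le_trans (by positivity) hh1
      have e2 : h * K 0 u v ≤ c * (c * m) :=
        mul_le_mul hh2 b2 (hm.le.trans b1) hc0.le
      have e3 : c * m - m / c ≤ m * (c ^ 2 - 1) := by
        have : m * (c ^ 2 - 1) - (c * m - m / c) = m * (c ^ 2 - 1) * (c - 1) / c := by
          field_simp
        have : 0 ≤ m * (c ^ 2 - 1) * (c - 1) / c := by
          have : 0 ≤ c - 1 := by linarith
          positivity
        linarith
      rw [abs_le]
      constructor <;> nlinarith
    · have e : f u * f v - g u * g v = f u * (f v - g v) + (f u - g u) * g v := by ring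
      have hcc : -c ≤ 1 / c := by linarith [show 0 < 1 / c by positivity]
      have p1 : |f u| ≤ c := abs_le.2 ⟨hcc.trans (hfc u).1, (hfc u).2⟩
      have p2 : |g v| ≤ c := abs_le.2 ⟨hcc.trans (hgc v).1, (hgc v).2⟩
      calc |f u * f v - g u * g v| ≤ |f u| * |f v - g v| + |f u - g u| * |g v| := by
            rw [e, ← abs_mul, ← abs_mul]; exact abs_add_le _ _
        _ ≤ c * d + d * c := by gcongr <;> apply hd
        _ = 2 * c * d := by ring
  have heq : lyap K f t / lyap K f 0 - h =
      (lyap K f t - lyap K g t - h * (lyap K f 0 - lyap K g 0)) / lyap K f 0 := by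
    rw [hh]
    field_simp
    ring
  rw [heq, abs_div, abs_of_pos hfpos, div_le_iff₀ hfpos]
  refine hbound.trans ?_
  have hk : 0 ≤ 2 * c ^ 3 * (c ^ 2 - 1) * d := by
    have hc2 : 0 ≤ c ^ 2 - 1 := by nlinarith
    positivity
  calc (m * (c ^ 2 - 1)) * (2 * c * d) = 2 * c ^ 3 * (c ^ 2 - 1) * d * (m / c ^ 2) := by
        field_simp
    _ ≤ _ := by gcongr

open scoped BoundedContinuousFunction in
/-- The bounded continuous functions with values in `[1 / c, c]`. -/
def boundedBand (c : ℝ) : Set (ℝ →ᵇ ℝ) := {f | ∀ t, f t ∈ Icc (1 / c) c}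

lemma isClosed_boundedBand (c : ℝ) : IsClosed (boundedBand c) := by
  simp only [boundedBand, ofPred_forall]
  exact isClosed_iInter fun t =>
    isClosed_Icc.preimage (continuous_eval_const t)

lemma exists_mem_boundedBand {c : ℝ} {f : ℝ → ℝ} (hf : Continuous f)
    (h : ∀ t, f t ∈ Icc (1 / c) c) : ∃ F : boundedBand c, ∀ t, F.1 t = f t := by
  have hc := fun t => (h t).2
  exact ⟨⟨BoundedContinuousFunction.ofNormedAddCommGroup f hf (max |1 / c| |c|)
    fun t => abs_le_max_abs_abs (h t).1 (h t).2, h⟩, fun _ => rfl⟩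

lemma two_mul_cube_mul_lt_one {c : ℝ} (hc1 : 1 < c)
    (hc2 : c < (1 / 2) * √(√17 + 1)) : 2 * c ^ 3 * (c ^ 2 - 1) < 1 := by
  have h17 : √17 < 4.1232 := by
    rw [Real.sqrt_lt' (by norm_num)]
    norm_num
  have h2 : √(√17 + 1) < 2.264 := by
    rw [Real.sqrt_lt' (by norm_num)]
    norm_num
    linarith
  have hc : c < 1.132 := by linarith
  calc 2 * c ^ 3 * (c ^ 2 - 1) ≤ 2 * 1.132 ^ 3 * (1.132 ^ 2 - 1) := by
        have : 0 ≤ c ^ 2 - 1 := by nlinarith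
        gcongr
    _ < 1 := by norm_num

/-- A positive continuous kernel on `ℝ³` with small oscillation admits a continuous function that is
on `[0, 1]` the only nontrivial nonnegative solution of `lyap K f t / lyap K f 0 = f t`. -/
lemma exists_unique_fixed_of_continuous {K : ℝ → ℝ → ℝ → ℝ} {m c : ℝ}
    (hK : Continuous fun p : ℝ × ℝ × ℝ => K p.1 p.2.1 p.2.2) (hm : 0 < m) (hc : 1 < c)
    (hc' : 2 * c ^ 3 * (c ^ 2 - 1) < 1) (hb : ∀ t u v, K t u v ∈ Icc m (c * m)) :
    ∃ f : ℝ → ℝ, Continuous f ∧ (∀ t, 0 < f t) ∧ (∀ t, lyap K f t / lyap K f 0 = f t) ∧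
      ∀ g : ℝ → ℝ, Continuous g → (∀ t ∈ Icc (0:ℝ) 1, 0 ≤ g t) → lyap K g 0 ≠ 0 →
        (∀ t ∈ Icc (0:ℝ) 1, lyap K g t / lyap K g 0 = g t) → EqOn g f (Icc 0 1) := by
  have hc0 : 0 < c := by linarith
  have hnonneg : ∀ F : boundedBand c, ∀ t ∈ Icc (0:ℝ) 1, 0 ≤ F.1 t :=
    fun F t _ => le_trans (by positivity) (F.2 t).1
  have hne : ∀ F : boundedBand c, lyap K F.1 0 ≠ 0 := fun F =>
    ((by positivity : 0 < m / c ^ 2).trans_le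
      (lyap_zero_lower hK hm hc0 hb F.1.continuous F.2 0)).ne'
  have hex : ∀ F : boundedBand c, ∃ G : boundedBand c, ∀ t, G.1 t = lyap K F.1 t / lyap K F.1 0 :=
    fun F => exists_mem_boundedBand ((continuous_lyap hK F.1.continuous).div_const _)
      (lyap_div_mem_Icc hK hm hc0 hb F.1.continuous (hnonneg F) (hne F))
  choose T hT using hex
  have hk : 0 ≤ 2 * c ^ 3 * (c ^ 2 - 1) := by
    have : 0 ≤ c ^ 2 - 1 := by nlinarith
    positivity
  have hcontr : ContractingWith (2 * c ^ 3 * (c ^ 2 - 1)).toNNReal T := by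
    refine ⟨Real.toNNReal_lt_one.2 hc', LipschitzWith.of_dist_le_mul fun F G => ?_⟩
    rw [Real.coe_toNNReal _ hk, Subtype.dist_eq, BoundedContinuousFunction.dist_le (mul_nonneg hk dist_nonneg)]
    intro t
    rw [hT, hT, Real.dist_eq]
    exact abs_lyap_div_sub_le hK hm hc hb F.1.continuous G.1.continuous F.2 G.2
      (fun s => by
        rw [← Real.dist_eq, Subtype.dist_eq]
        exact BoundedContinuousFunction.dist_coe_le_dist s) t
  have : CompleteSpace (boundedBand c) := (isClosed_boundedBand c).completeSpace_coe
  have : Nonempty (boundedBand c) :=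
    ⟨(exists_mem_boundedBand (c := c) continuous_const
      (fun _ => ⟨by rw [div_le_one hc0]; exact hc.le, hc.le⟩ : ∀ _ : ℝ, (1:ℝ) ∈ Icc (1 / c) c)).choose⟩
  set F := ContractingWith.fixedPoint T hcontr with hF
  have hFT : T F = F := hcontr.fixedPoint_isFixedPt
  refine ⟨F.1, F.1.continuous, fun t => lt_of_lt_of_le (by positivity) (F.2 t).1,
    fun t => by rw [← hT, hFT], fun g hg hg0 hgne hgfix => ?_⟩
  obtain ⟨G, hG⟩ := exists_mem_boundedBand ((continuous_lyap hK hg).div_const _)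
    (lyap_div_mem_Icc hK hm hc0 hb hg hg0 hgne)
  have hGg : EqOn g G.1 (Icc 0 1) := fun t ht => by rw [hG, hgfix t ht]
  have hlyap : ∀ t, lyap K g t = lyap K G.1 t := fun t => lyap_congr (fun _ _ _ _ => rfl) hGg
  have hTG : T G = G := by
    ext t
    rw [hT, hG, hlyap, hlyap]
  intro t ht
  rw [hGg ht, hcontr.fixedPoint_unique hTG]

/-- If `max K < c · min K` over `[0,1]³` for some `c` with
`1 < c < (1/2)·√(√17 + 1)`, then the equation `H f = f`, i.e.
`(L f)(t)/(L f)(0) = f(t)` on `[0,1]`, has exactly one solution in `C₀⁺[0,1]`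
(uniqueness meaning equality of solutions on `[0,1]`). -/
theorem hfix_unique
    (K : ℝ → ℝ → ℝ → ℝ)
    (hK : ContinuousOn (fun p : ℝ × ℝ × ℝ => K p.1 p.2.1 p.2.2)
      ((Set.Icc 0 1) ×ˢ (Set.Icc 0 1) ×ˢ (Set.Icc 0 1)))
    (hKpos : ∀ t ∈ Set.Icc (0:ℝ) 1, ∀ u ∈ Set.Icc (0:ℝ) 1, ∀ v ∈ Set.Icc (0:ℝ) 1,
      0 < K t u v)
    (Om om c : ℝ)
    (hOm : ∀ t ∈ Set.Icc (0:ℝ) 1, ∀ u ∈ Set.Icc (0:ℝ) 1, ∀ v ∈ Set.Icc (0:ℝ) 1,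
      K t u v ≤ Om)
    (hOmmem : ∃ t ∈ Set.Icc (0:ℝ) 1, ∃ u ∈ Set.Icc (0:ℝ) 1, ∃ v ∈ Set.Icc (0:ℝ) 1,
      K t u v = Om)
    (hom : ∀ t ∈ Set.Icc (0:ℝ) 1, ∀ u ∈ Set.Icc (0:ℝ) 1, ∀ v ∈ Set.Icc (0:ℝ) 1,
      om ≤ K t u v)
    (hommem : ∃ t ∈ Set.Icc (0:ℝ) 1, ∃ u ∈ Set.Icc (0:ℝ) 1, ∃ v ∈ Set.Icc (0:ℝ) 1,
      K t u v = om)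
    (hc1 : 1 < c) (hc2 : c < (1 / 2) * Real.sqrt (Real.sqrt 17 + 1))
    (hcond : Om < c * om) :
    ∃ f : ℝ → ℝ,
      (ContinuousOn f (Set.Icc 0 1) ∧
        (∀ t ∈ Set.Icc (0:ℝ) 1, 0 ≤ f t) ∧
        (∃ t ∈ Set.Icc (0:ℝ) 1, f t ≠ 0) ∧
        (∀ t ∈ Set.Icc (0:ℝ) 1, lyap K f t / lyap K f 0 = f t)) ∧
      ∀ f' : ℝ → ℝ,
        (ContinuousOn f' (Set.Icc 0 1) ∧
          (∀ t ∈ Set.Icc (0:ℝ) 1, 0 ≤ f' t) ∧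
          (∃ t ∈ Set.Icc (0:ℝ) 1, f' t ≠ 0) ∧
          (∀ t ∈ Set.Icc (0:ℝ) 1, lyap K f' t / lyap K f' 0 = f' t)) →
        Set.EqOn f' f (Set.Icc 0 1) := by
  have hproj : ∀ {t : ℝ}, t ∈ Icc (0:ℝ) 1 → (projIcc (0:ℝ) 1 zero_le_one t : ℝ) = t :=
    fun ht => by rw [projIcc_of_mem zero_le_one ht]
  set p : ℝ → ℝ := fun t => projIcc (0:ℝ) 1 zero_le_one t with hp
  have hpc : Continuous p := continuous_subtype_val.comp continuous_projIcc
  have hpm : ∀ t, p t ∈ Icc (0:ℝ) 1 := fun t => (projIcc (0:ℝ) 1 zero_le_one t).2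
  have hm : 0 < om := by
    obtain ⟨t, ht, u, hu, v, hv, h⟩ := hommem
    exact h ▸ hKpos t ht u hu v hv
  have hK' : Continuous fun q : ℝ × ℝ × ℝ => K (p q.1) (p q.2.1) (p q.2.2) :=
    hK.comp_continuous (f := fun q : ℝ × ℝ × ℝ => (p q.1, p q.2.1, p q.2.2)) (by fun_prop)
      fun q => ⟨hpm _, hpm _, hpm _⟩
  have hlyap : ∀ {f g : ℝ → ℝ}, EqOn f g (Icc 0 1) → ∀ t ∈ Icc (0:ℝ) 1,
      lyap K f t = lyap (fun t u v => K (p t) (p u) (p v)) g t := fun hfg t ht =>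
    lyap_congr (fun u hu v hv => by simp only [hp, hproj ht, hproj hu, hproj hv]) hfg
  have h0 : (0:ℝ) ∈ Icc (0:ℝ) 1 := ⟨le_rfl, zero_le_one⟩
  obtain ⟨f, hf, hfpos, hfix, huniq⟩ := exists_unique_fixed_of_continuous hK' hm hc1
    (two_mul_cube_mul_lt_one hc1 hc2) fun t u v =>
      ⟨hom _ (hpm t) _ (hpm u) _ (hpm v), (hOm _ (hpm t) _ (hpm u) _ (hpm v)).trans hcond.le⟩
  refine ⟨f, ⟨hf.continuousOn, fun t _ => (hfpos t).le, ⟨0, h0, (hfpos 0).ne'⟩, fun t ht => ?_⟩, ?_⟩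
  · rw [hlyap (eqOn_refl f _) t ht, hlyap (eqOn_refl f _) 0 h0, hfix]
  rintro g ⟨hg, hg0, ⟨s, hs, hgs⟩, hgfix⟩
  have hgp : EqOn g (fun t => g (p t)) (Icc 0 1) := fun t ht => by simp only [hp, hproj ht]
  have hfix' : ∀ t ∈ Icc (0:ℝ) 1, lyap (fun t u v => K (p t) (p u) (p v)) (fun t => g (p t)) t /
      lyap (fun t u v => K (p t) (p u) (p v)) (fun t => g (p t)) 0 = g (p t) := fun t ht => by
    rw [← hlyap hgp t ht, ← hlyap hgp 0 h0, hgfix t ht, hgp ht]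
  refine hgp.trans (huniq _ (hg.comp_continuous hpc hpm) (fun t _ => hg0 _ (hpm t)) ?_ hfix')
  intro hz
  apply hgs
  rw [show g s = g (p s) from hgp hs, ← hfix' s hs, hz, div_zero]
end
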